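/- Let S_1 ⊆ … ⊆ S_n be a chain of nonempty proper subsets of [n+1], let λ be the Young diagram with λ_i = |S_{n+1−i}|, and let s, b_r, c_r be the associated corner data. If there exists r ∈ {1,…,s} with c_r < 0 or c_r > b_r (equivalently, some step of the zigzag line of lower-right corners of λ fails to cross the anti-diagonal line shifted down half the length of a box), then τ_{S_1}·τ_{S_2}⋯τ_{S_n} = 0 in R_n. -/

import Mathlib

open MvPolynomial

/-- Index type: nonempty proper subsets of `[n+1]` (realized as `Fin (n+1)`). -/
abbrev IdxA (n : ℕ) := {S : Finset (Fin (n + 1)) // S.Nonempty ∧ S ≠ Finset.univ}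

/-- Generators of the defining ideal of `R_n`: (i) products `τ_S τ_T` for incomparable `S, T`;
(ii) the linear relations `Σ_{k∈S, l∉S} τ_S − Σ_{k∉S, l∈S} τ_S` for `k, l ∈ [n+1]`. -/
def relA (n : ℕ) : Set (MvPolynomial (IdxA n) ℤ) :=
  {p | ∃ S T : IdxA n, ¬ S.1 ⊆ T.1 ∧ ¬ T.1 ⊆ S.1 ∧ p = X S * X T} ∪
  {p | ∃ k l : Fin (n + 1), p =
      (∑ S : IdxA n, if k ∈ S.1 ∧ l ∉ S.1 then X S else 0) -
      (∑ S : IdxA n, if k ∉ S.1 ∧ l ∈ S.1 then X S else 0)}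

/-- The ring `R_n`. -/
abbrev RA (n : ℕ) := MvPolynomial (IdxA n) ℤ ⧸ Ideal.span (relA n)

/-- The class `τ_S ∈ R_n`, with the convention `τ_∅ = τ_{[n+1]} = 1`. -/
noncomputable def tauA (n : ℕ) (S : Finset (Fin (n + 1))) : RA n :=
  if h : S.Nonempty ∧ S ≠ Finset.univ then Ideal.Quotient.mk _ (X (⟨S, h⟩ : IdxA n)) else 1

/-- The subset `{1, …, i}` of `[n+1]`, as a subset of `Fin (n+1)`. -/
def initSeg (n i : ℕ) : Finset (Fin (n + 1)) :=
  Finset.univ.filter (fun x : Fin (n + 1) => (x : ℕ) < i)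

/-- The class of a point: `τ_{{1}} ⋯ τ_{{1,…,n}}`. -/
noncomputable def ptA (n : ℕ) : RA n := ∏ i ∈ Finset.Icc 1 n, tauA n (initSeg n i)

/-- `λ_i` extended by `0` for `i > n`. -/
def lamE (n : ℕ) (lam : ℕ → ℕ) (i : ℕ) : ℕ := if i ≤ n then lam i else 0

/-- The sorted list `i_1 < … < i_s` of lower-right corners of `λ`. -/
def cornerL (n : ℕ) (lam : ℕ → ℕ) : List ℕ :=
  ((Finset.Icc 1 n).filter (fun i => lamE n lam (i + 1) < lamE n lam i)).sort (· ≤ ·)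

/-- The number `s` of lower-right corners of `λ`. -/
def sC (n : ℕ) (lam : ℕ → ℕ) : ℕ := (cornerL n lam).length

/-- `i_r` (with `i_0 = 0`; out-of-range indices default to `n+1`, where `λ` vanishes). -/
def iC (n : ℕ) (lam : ℕ → ℕ) (r : ℕ) : ℕ :=
  if r = 0 then 0 else (cornerL n lam).getD (r - 1) (n + 1)

/-- `a_r = i_r − i_{r−1} − 1`. -/
def aC (n : ℕ) (lam : ℕ → ℕ) (r : ℕ) : ℤ := (iC n lam r : ℤ) - iC n lam (r - 1) - 1

/-- `b_r = λ_{i_r} − λ_{i_{r+1}} − 1` (with `λ_{i_{s+1}} = 0`). -/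
def bC (n : ℕ) (lam : ℕ → ℕ) (r : ℕ) : ℤ :=
  (lamE n lam (iC n lam r) : ℤ) - lamE n lam (iC n lam (r + 1)) - 1

/-- `c_r = λ_{i_r} + i_r − n − 1`. -/
def cC (n : ℕ) (lam : ℕ → ℕ) (r : ℕ) : ℤ :=
  (lamE n lam (iC n lam r) : ℤ) + iC n lam r - n - 1

/-- Binomial coefficient `C(x,y)` with `C(x,y) = 0` unless `0 ≤ y ≤ x`. -/
def Cb (x y : ℤ) : ℤ := if 0 ≤ y ∧ y ≤ x then (x.toNat.choose y.toNat : ℤ) else 0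

/-- `y_r = C(a_r, c_r) · C(b_r, c_r)`. -/
def yC (n : ℕ) (lam : ℕ → ℕ) (r : ℕ) : ℤ :=
  Cb (aC n lam r) (cC n lam r) * Cb (bC n lam r) (cC n lam r)

/-- `I(λ) = (−1)^{n+s} y_1 ⋯ y_s`. -/
def IY (n : ℕ) (lam : ℕ → ℕ) : ℤ :=
  (-1) ^ (n + sC n lam) * ∏ r ∈ Finset.Icc 1 (sC n lam), yC n lam r

section ChainProducts

variable {α A : Type*} [CommRing A]

/-- A product containing two factors indexed by incomparable sets vanishes. -/
lemma mul_mul_eq_zero_of_incomparable {t : Finset α → A}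
    (hinc : ∀ S T : Finset α, ¬ S ⊆ T → ¬ T ⊆ S → t S * t T = 0) {p : A} {S U : Finset α}
    (hp : t S ∣ p) (h₁ : ¬ S ⊆ U) (h₂ : ¬ U ⊆ S) : p * t U = 0 := by
  obtain ⟨q, rfl⟩ := hp
  rw [mul_right_comm, hinc S U h₁ h₂, zero_mul]

variable [DecidableEq α] [Fintype α]

/-- If `t` satisfies the defining relations of `R_n`, then `t T` annihilates every product of at
least `#T` factors indexed by nonempty proper subsets of `T`. -/
theorem mul_prod_ssubset_eq_zero {t : Finset α → A}
    (hinc : ∀ S T : Finset α, ¬ S ⊆ T → ¬ T ⊆ S → t S * t T = 0)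
    (hlin : ∀ k l : α, (∑ S, if k ∈ S ∧ l ∉ S then t S else 0) =
      ∑ S, if k ∉ S ∧ l ∈ S then t S else 0)
    (T : Finset α) (hT : T.Nonempty) (M : Multiset (Finset α))
    (hM : ∀ B ∈ M, B.Nonempty ∧ B ⊂ T) (hcard : T.card ≤ M.card) :
    t T * (M.map t).prod = 0 := by
  induction T using Finset.strongInduction generalizing M with
  | H T ih =>
  -- the case where the largest factor `S` contains all the others
  have key : ∀ S : Finset α, S.Nonempty → S ⊂ T → ∀ (m : ℕ) (N : Multiset (Finset α)),
      (∀ B ∈ N, B.Nonempty ∧ B ⊂ S) → T.card ≤ m + 1 + N.card →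
      t T * t S ^ (m + 1) * (N.map t).prod = 0 := by
    intro S hS hST m
    have hlt := Finset.card_lt_card hST
    induction m with
    | zero =>
      intro N hN hc
      have h := ih S hST hS N hN (by omega)
      rw [zero_add, pow_one, mul_assoc, h, mul_zero]
    | succ m ihm =>
      intro N hN hc
      obtain ⟨k, hk⟩ := hS
      obtain ⟨l, hlT, hlS⟩ := Finset.exists_of_ssubset hST
      set P := t T * t S ^ (m + 1) * (N.map t).prod with hP
      have hSP : t S ∣ P := by
        rw [hP, pow_succ]
        exact ⟨t T * t S ^ m * (N.map t).prod, by ring⟩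
      have hTP : t T ∣ P := ⟨t S ^ (m + 1) * (N.map t).prod, by rw [hP, mul_assoc]⟩
      have hrel := congrArg (P * ·) (hlin k l)
      simp only [Finset.mul_sum, mul_ite, mul_zero] at hrel
      rw [Finset.sum_eq_single S, if_pos ⟨hk, hlS⟩, Finset.sum_eq_zero] at hrel
      · rw [← hrel, hP]
        ring
      · intro U _
        split_ifs with hU
        · exact mul_mul_eq_zero_of_incomparable hinc hSP (fun h => hU.1 (h hk))
            (fun h => hlS (h hU.2))
        · rfl
      · intro U _ hUS
        split_ifs with hU
        · by_cases h₁ : U ⊆ S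
          · have h := ihm (U ::ₘ N) (fun B hB => by
              rcases Multiset.mem_cons.1 hB with rfl | hB
              · exact ⟨⟨k, hU.1⟩, h₁.ssubset_of_ne hUS⟩
              · exact hN B hB) (by rw [Multiset.card_cons]; omega)
            rw [Multiset.map_cons, Multiset.prod_cons] at h
            rw [← h, hP]
            ring
          by_cases h₂ : S ⊆ U
          · by_cases h₃ : U ⊆ T
            · have hUT : U ⊂ T := h₃.ssubset_of_ne fun h => hU.2 (h ▸ hlT)
              have hSU : S ⊂ U := h₂.ssubset_of_ne hUS.symm
              have hUc := Finset.card_lt_card hUT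
              have h := ih U hUT ⟨k, hU.1⟩ (Multiset.replicate (m + 1) S + N) (fun B hB => by
                rcases Multiset.mem_add.1 hB with hB | hB
                · rw [Multiset.eq_of_mem_replicate hB]
                  exact ⟨⟨k, hk⟩, hSU⟩
                · exact ⟨(hN B hB).1, (hN B hB).2.trans hSU⟩)
                (by rw [Multiset.card_add, Multiset.card_replicate]; omega)
              rw [Multiset.map_add, Multiset.prod_add, Multiset.map_replicate,
                Multiset.prod_replicate] at h
              calc P * t U = t T * (t U * (t S ^ (m + 1) * (N.map t).prod)) := by rw [hP]; ring
                _ = 0 := by rw [h, mul_zero]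
            · exact mul_mul_eq_zero_of_incomparable hinc hTP (fun h => hU.2 (h hlT)) h₃
          · exact mul_mul_eq_zero_of_incomparable hinc hSP h₂ h₁
        · rfl
      · exact fun h => absurd (Finset.mem_univ S) h
  have hTpos := hT.card_pos
  have hM0 : M.toFinset.Nonempty := by
    rw [Multiset.toFinset_nonempty]
    rintro rfl
    rw [Multiset.card_zero] at hcard
    omega
  obtain ⟨S, hSM, hmax⟩ := Finset.exists_max_image M.toFinset Finset.card hM0
  rw [Multiset.mem_toFinset] at hSM
  by_cases hcomp : ∀ B ∈ M, B ⊆ S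
  · have hsplit := Multiset.filter_add_not (fun B => B = S) M
    rw [Multiset.filter_eq'] at hsplit
    obtain ⟨m, hm⟩ := Nat.exists_eq_succ_of_ne_zero (Multiset.count_pos.2 hSM).ne'
    have hc := congrArg Multiset.card hsplit
    rw [Multiset.card_add, Multiset.card_replicate, hm] at hc
    have h := key S (hM S hSM).1 (hM S hSM).2 m (M.filter fun B => ¬ B = S)
      (fun B hB => by
        rw [Multiset.mem_filter] at hB
        exact ⟨(hM B hB.1).1, (hcomp B hB.1).ssubset_of_ne hB.2⟩) (by omega)
    rw [← hsplit, Multiset.map_add, Multiset.prod_add, Multiset.map_replicate,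
      Multiset.prod_replicate, hm, ← mul_assoc]
    exact h
  · push Not at hcomp
    obtain ⟨B, hBM, hBS⟩ := hcomp
    have hSB : ¬ S ⊆ B := fun h =>
      hBS (Finset.eq_of_subset_of_card_le h (hmax B (Multiset.mem_toFinset.2 hBM))).ge
    have hne : B ≠ S := fun h => hBS h.le
    obtain ⟨M', rfl⟩ := Multiset.exists_cons_of_mem hSM
    obtain ⟨M'', rfl⟩ := Multiset.exists_cons_of_mem ((Multiset.mem_cons.1 hBM).resolve_left hne)
    simp only [Multiset.map_cons, Multiset.prod_cons]
    rw [← mul_assoc (t S), hinc S B hSB hBS, zero_mul, mul_zero]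

/-- The statement dual to `mul_prod_ssubset_eq_zero` under complementation: `t T` annihilates every
product of at least `#Tᶜ` factors indexed by proper subsets of `α` strictly containing `T`. -/
theorem mul_prod_ssuperset_eq_zero {t : Finset α → A}
    (hinc : ∀ S T : Finset α, ¬ S ⊆ T → ¬ T ⊆ S → t S * t T = 0)
    (hlin : ∀ k l : α, (∑ S, if k ∈ S ∧ l ∉ S then t S else 0) =
      ∑ S, if k ∉ S ∧ l ∈ S then t S else 0)
    (T : Finset α) (hT : T ≠ Finset.univ) (M : Multiset (Finset α))
    (hM : ∀ B ∈ M, B ≠ Finset.univ ∧ T ⊂ B) (hcard : Tᶜ.card ≤ M.card) :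
    t T * (M.map t).prod = 0 := by
  have h := mul_prod_ssubset_eq_zero (t := fun S => t Sᶜ)
    (fun S U h₁ h₂ => hinc _ _ (by rwa [Finset.compl_subset_compl])
      (by rwa [Finset.compl_subset_compl]))
    (fun k l => by
      have h := hlin l k
      let e : Equiv.Perm (Finset α) := compl_involutive.toPerm
      rw [← Equiv.sum_comp e, ← Equiv.sum_comp e (fun S => if l ∉ S ∧ k ∈ S then t S else 0)] at h
      simpa [e, and_comm] using h)
    Tᶜ (by rwa [Finset.nonempty_iff_ne_empty, Ne, Finset.compl_eq_empty_iff]) (M.map compl)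
    (fun B hB => by
      obtain ⟨C, hC, rfl⟩ := Multiset.mem_map.1 hB
      exact ⟨by rw [Finset.nonempty_iff_ne_empty, Ne, Finset.compl_eq_empty_iff]; exact (hM C hC).1,
        Finset.compl_ssubset_compl.2 (hM C hC).2⟩)
    (by rwa [Multiset.card_map])
  simpa [Multiset.map_map] using h

end ChainProducts

lemma tauA_mul_eq_zero (n : ℕ) (S T : Finset (Fin (n + 1))) (h₁ : ¬ S ⊆ T) (h₂ : ¬ T ⊆ S) :
    tauA n S * tauA n T = 0 := by
  have hS : S.Nonempty ∧ S ≠ Finset.univ :=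
    ⟨Finset.nonempty_iff_ne_empty.2 fun h => h₁ (by simp [h]), fun h => h₂ (by simp [h])⟩
  have hT : T.Nonempty ∧ T ≠ Finset.univ :=
    ⟨Finset.nonempty_iff_ne_empty.2 fun h => h₂ (by simp [h]), fun h => h₁ (by simp [h])⟩
  rw [tauA, tauA, dif_pos hS, dif_pos hT, ← map_mul, Ideal.Quotient.eq_zero_iff_mem]
  exact Ideal.subset_span (Or.inl ⟨⟨S, hS⟩, ⟨T, hT⟩, h₁, h₂, rfl⟩)

lemma sum_tauA_eq_sum_idxA (n : ℕ) (p : Finset (Fin (n + 1)) → Prop) [DecidablePred p]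
    (hp : ∀ S, p S → S.Nonempty ∧ S ≠ Finset.univ) :
    (∑ S, if p S then tauA n S else 0) =
      Ideal.Quotient.mk (Ideal.span (relA n)) (∑ S : IdxA n, if p S.1 then X S else 0) := by
  rw [map_sum]
  have h : ∀ S : IdxA n, Ideal.Quotient.mk (Ideal.span (relA n)) (if p S.1 then X S else 0) =
      if p S.1 then tauA n S.1 else 0 := by
    intro S
    split_ifs
    · rw [tauA, dif_pos S.2]
    · exact map_zero _
  rw [Finset.sum_congr rfl fun S _ => h S,
    ← Finset.sum_subtype (Finset.univ.filter fun S => S.Nonempty ∧ S ≠ Finset.univ)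
      (by simp) (fun S => if p S then tauA n S else 0), Finset.sum_filter]
  refine Finset.sum_congr rfl fun S _ => ?_
  by_cases hS : p S
  · rw [if_pos (hp S hS)]
  · rw [if_neg hS, ite_self]

lemma sum_tauA_eq (n : ℕ) (k l : Fin (n + 1)) :
    (∑ S, if k ∈ S ∧ l ∉ S then tauA n S else 0) =
      ∑ S, if k ∉ S ∧ l ∈ S then tauA n S else 0 := by
  rw [sum_tauA_eq_sum_idxA n (fun S => k ∈ S ∧ l ∉ S)
      (fun S h => ⟨⟨k, h.1⟩, fun hS => h.2 (hS ▸ Finset.mem_univ l)⟩),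
    sum_tauA_eq_sum_idxA n (fun S => k ∉ S ∧ l ∈ S)
      (fun S h => ⟨⟨l, h.2⟩, fun hS => h.1 (hS ▸ Finset.mem_univ k)⟩),
    Ideal.Quotient.eq]
  exact Ideal.subset_span (Or.inr ⟨k, l, rfl⟩)

/-- The values `i_1, …, i_s` are the corners of `λ`. -/
lemma iC_mem (n : ℕ) (lam : ℕ → ℕ) {r : ℕ} (h1 : 1 ≤ r) (hr : r ≤ sC n lam) :
    1 ≤ iC n lam r ∧ iC n lam r ≤ n ∧
      lamE n lam (iC n lam r + 1) < lamE n lam (iC n lam r) := by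
  have hlt : r - 1 < (cornerL n lam).length := by
    rw [sC] at hr
    omega
  have hmem : iC n lam r ∈ cornerL n lam := by
    rw [iC, if_neg (by omega), List.getD_eq_getElem _ _ hlt]
    exact List.getElem_mem hlt
  rw [cornerL, Finset.mem_sort, Finset.mem_filter, Finset.mem_Icc] at hmem
  exact ⟨hmem.1.1, hmem.1.2, hmem.2⟩

lemma iC_lt_iC_succ (n : ℕ) (lam : ℕ → ℕ) {r : ℕ} (h1 : 1 ≤ r) (hr : r < sC n lam) :
    iC n lam r < iC n lam (r + 1) := by
  have hlt : r < (cornerL n lam).length := hr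
  rw [iC, if_neg (by omega), iC, if_neg (by omega), List.getD_eq_getElem _ _ (by omega),
    List.getD_eq_getElem _ _ (by omega)]
  have hs : (cornerL n lam).SortedLT := Finset.sortedLT_sort _
  exact hs.strictMono_get (a := ⟨r - 1, by omega⟩) (b := ⟨r, by omega⟩)
    (Fin.mk_lt_mk.2 (by omega))

lemma iC_succ_sC (n : ℕ) (lam : ℕ → ℕ) : iC n lam (sC n lam + 1) = n + 1 := by
  rw [iC, if_neg (by omega), sC, Nat.add_sub_cancel, List.getD_eq_default _ _ le_rfl]

/-- A product over `[1, n]` vanishes as soon as one factor annihilates a subproduct of the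
others. -/
lemma prod_eq_zero_of_mul_prod_eq_zero {ι A : Type*} [DecidableEq ι] [CommRing A] {s u : Finset ι}
    (f : ι → A) {j : ι} (hj : j ∈ s) (hu : u ⊆ s) (hju : j ∉ u) (h : f j * ∏ i ∈ u, f i = 0) :
    ∏ i ∈ s, f i = 0 := by
  rw [← Finset.prod_insert hju] at h
  exact zero_dvd_iff.1 (h ▸ Finset.prod_dvd_prod_of_subset _ _ f (Finset.insert_subset hj hu))

/-- vanishing property. For a chain `S_1 ⊆ … ⊆ S_n` of nonempty proper
subsets of `[n+1]` with `λ_i = |S_{n+1−i}|`: if some `r ∈ {1,…,s}` has `c_r < 0` or `c_r > b_r`,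
then `τ_{S_1} ⋯ τ_{S_n} = 0` in `R_n`. -/
theorem typeA_vanishing (n : ℕ) (hn : 1 ≤ n)
    (S : ℕ → Finset (Fin (n + 1)))
    (hne : ∀ i ∈ Finset.Icc 1 n, (S i).Nonempty)
    (hpr : ∀ i ∈ Finset.Icc 1 n, S i ≠ Finset.univ)
    (hchain : ∀ i j, 1 ≤ i → i ≤ j → j ≤ n → S i ⊆ S j)
    (hbad : ∃ r ∈ Finset.Icc 1 (sC n (fun i => (S (n + 1 - i)).card)),
        cC n (fun i => (S (n + 1 - i)).card) r < 0 ∨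
        bC n (fun i => (S (n + 1 - i)).card) r < cC n (fun i => (S (n + 1 - i)).card) r) :
    (∏ i ∈ Finset.Icc 1 n, tauA n (S i)) = 0 := by
  obtain ⟨r, hr, hbad⟩ := hbad
  rw [Finset.mem_Icc] at hr
  set lam : ℕ → ℕ := fun i => (S (n + 1 - i)).card with hlam
  obtain ⟨hi1, hin, hcor⟩ := iC_mem n lam hr.1 hr.2
  rcases hbad with hneg | hbig
  · rw [cC] at hneg
    set i := iC n lam r
    have hli : lamE n lam i = (S (n + 1 - i)).card := by rw [lamE, if_pos hin]
    have hpos := (hne (n + 1 - i) (Finset.mem_Icc.2 (by omega))).card_pos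
    have hlt : i < n := by omega
    have hli' : lamE n lam (i + 1) = (S (n - i)).card := by
      rw [lamE, if_pos (by omega), hlam]
      simp
    refine prod_eq_zero_of_mul_prod_eq_zero (fun i => tauA n (S i)) (j := n + 1 - i)
      (u := Finset.Icc 1 (n - i)) (Finset.mem_Icc.2 (by omega))
      (Finset.Icc_subset_Icc le_rfl (by omega)) (by rw [Finset.mem_Icc]; omega) ?_
    have h := mul_prod_ssubset_eq_zero (tauA_mul_eq_zero n) (sum_tauA_eq n) (S (n + 1 - i))
      (Finset.card_pos.1 hpos) ((Finset.Icc 1 (n - i)).val.map S) (fun B hB => by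
        obtain ⟨x, hx, rfl⟩ := Multiset.mem_map.1 hB
        rw [Finset.mem_val, Finset.mem_Icc] at hx
        refine ⟨hne x (Finset.mem_Icc.2 (by omega)),
          (hchain x _ hx.1 (by omega) (by omega)).ssubset_of_ne fun h => ?_⟩
        have hle := Finset.card_le_card (hchain x (n - i) hx.1 hx.2 (by omega))
        rw [h] at hle
        omega) (by rw [Multiset.card_map, Finset.card_val, Nat.card_Icc]; omega)
    rw [Multiset.map_map] at h
    exact h
  · rw [cC, bC] at hbig
    have hrs : r < sC n lam := by
      rcases hr.2.lt_or_eq with h | h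
      · exact h
      · rw [h, iC_succ_sC, ← h] at hbig
        have h0 : lamE n lam (n + 1) = 0 := by rw [lamE, if_neg (by omega)]
        omega
    obtain ⟨hi1', hin', -⟩ := iC_mem n lam (r := r + 1) (by omega) hrs
    have hii := iC_lt_iC_succ n lam hr.1 hrs
    set i := iC n lam r
    set i' := iC n lam (r + 1)
    have hli : lamE n lam i = (S (n + 1 - i)).card := by rw [lamE, if_pos hin]
    have hli' : lamE n lam i' = (S (n + 1 - i')).card := by rw [lamE, if_pos hin']
    have hli₁ : lamE n lam (i + 1) = (S (n - i)).card := by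
      rw [lamE, if_pos (by omega), hlam]
      simp
    have hmono := Finset.card_le_card
      (hchain (n + 1 - i') (n - i) (by omega) (by omega) (by omega))
    refine prod_eq_zero_of_mul_prod_eq_zero (fun i => tauA n (S i)) (j := n + 1 - i')
      (u := Finset.Icc (n + 1 - i) n) (Finset.mem_Icc.2 (by omega))
      (Finset.Icc_subset_Icc (by omega) le_rfl) (by rw [Finset.mem_Icc]; omega) ?_
    have h := mul_prod_ssuperset_eq_zero (tauA_mul_eq_zero n) (sum_tauA_eq n) (S (n + 1 - i'))
      (hpr _ (Finset.mem_Icc.2 (by omega))) ((Finset.Icc (n + 1 - i) n).val.map S) (fun B hB => by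
        obtain ⟨x, hx, rfl⟩ := Multiset.mem_map.1 hB
        rw [Finset.mem_val, Finset.mem_Icc] at hx
        refine ⟨hpr x (Finset.mem_Icc.2 (by omega)),
          (hchain _ x (by omega) (by omega) hx.2).ssubset_of_ne fun h => ?_⟩
        have hle := Finset.card_le_card (hchain (n + 1 - i) x (by omega) hx.1 hx.2)
        rw [← h] at hle
        omega) (by
          rw [Multiset.card_map, Finset.card_val, Nat.card_Icc, Finset.card_compl,
            Fintype.card_fin]
          omega)
    rw [Multiset.map_map] at h
    exact h
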